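/- arXiv:1710.10199 — 8 statements merged into one kernel-verified Lean document; each statement's English description precedes it below -/
import Mathlib

section
/- If the prime spectrum Spec R of a commutative ring R is a Noetherian topological space (for instance, if R is a Noetherian ring), then every point of Spec R is visible. -/
/-- A subset of `Spec R` is *Thomason* if it is a union of closed subsets,
each of which has quasi-compact (open) complement. -/
def IsThomason {R : Type*} [CommRing R] (V : Set (PrimeSpectrum R)) : Prop :=
  ∃ S : Set (Set (PrimeSpectrum R)),
    (∀ C ∈ S, IsClosed C ∧ IsCompact Cᶜ ∧ IsOpen Cᶜ) ∧ V = ⋃₀ S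

/-- A point `p` of `Spec R` is *visible* if there are Thomason subsets `V`, `U`
with `{p} = V ∩ Uᶜ`. -/
def VisiblePoint {R : Type*} [CommRing R] (p : PrimeSpectrum R) : Prop :=
  ∃ V U : Set (PrimeSpectrum R), IsThomason V ∧ IsThomason U ∧
    ({p} : Set (PrimeSpectrum R)) = V ∩ Uᶜ

/-- In a Noetherian prime spectrum, every specialization-stable subset is Thomason. -/
theorem IsThomason.of_stableUnderSpecialization {R : Type*} [CommRing R]
    [TopologicalSpace.NoetherianSpace (PrimeSpectrum R)] {V : Set (PrimeSpectrum R)}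
    (hV : StableUnderSpecialization V) : IsThomason V := by
  refine ⟨(fun q => closure {q}) '' V, ?_, ?_⟩
  · rintro _ ⟨q, -, rfl⟩
    exact ⟨isClosed_closure, TopologicalSpace.NoetherianSpace.isCompact _,
      isClosed_closure.isOpen_compl⟩
  · ext x
    simp only [Set.sUnion_image, Set.mem_iUnion, exists_prop]
    exact ⟨fun hx => ⟨x, hx, subset_closure rfl⟩,
      fun ⟨_, hq, hx⟩ => hV (specializes_iff_mem_closure.mpr hx) hq⟩

theorem stmt_1 {R : Type*} [CommRing R]
    [TopologicalSpace.NoetherianSpace (PrimeSpectrum R)] :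
    ∀ p : PrimeSpectrum R, VisiblePoint p := by
  intro p
  refine ⟨{q | p ⤳ q}, {q | ¬ q ⤳ p},
    .of_stableUnderSpecialization fun _ _ hxy hx => Specializes.trans hx hxy,
    .of_stableUnderSpecialization fun _ _ hxy hx hy => hx (hxy.trans hy), ?_⟩
  ext q
  simp only [Set.mem_singleton_iff, Set.mem_inter_iff, Set.mem_ofPred_eq, Set.mem_compl_iff,
    not_not]
  exact ⟨fun h => h ▸ ⟨specializes_rfl, specializes_rfl⟩, fun h => h.2.antisymm h.1 |>.eq⟩
end

section
/- Let R be a commutative ring, M an R-module, and p a prime ideal of R that is weakly associated to M. Then for every finite sequence x₁,…,xₙ of elements of p, the (x₁,…,xₙ)-torsion submodule of the localization M_p of M at p is nonzero. -/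
/-- `p` is *weakly associated* to `M` if there is `m : M` such that `p` is minimal
among primes containing the annihilator of `m`. -/
def WeaklyAssociated {R : Type*} [CommRing R] (p : Ideal R)
    (M : Type*) [AddCommGroup M] [Module R M] : Prop :=
  ∃ m : M, p ∈ (Ideal.torsionOf R M m).minimalPrimes

theorem stmt_4 {R M : Type*} [CommRing R] [AddCommGroup M] [Module R M]
    (p : Ideal R) [p.IsPrime] (hp : WeaklyAssociated p M)
    (n : ℕ) (x : Fin n → R) (hx : ∀ i, x i ∈ p) :
    ∃ m : LocalizedModule p.primeCompl M, m ≠ 0 ∧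
      ∃ k : ℕ, ∀ r ∈ Ideal.span (Set.range x) ^ k, r • m = 0 := by
  obtain ⟨m, hm⟩ := hp
  let A := Localization.AtPrime p
  let f := LocalizedModule.mkLinearMap p.primeCompl M
  have hrad := IsLocalization.AtPrime.radical_map_of_mem_minimalPrimes A p _ hm
  have hle : (Ideal.span (Set.range x)).map (algebraMap R A) ≤
      ((Ideal.torsionOf R M m).map (algebraMap R A)).radical := by
    rw [hrad]
    refine Ideal.map_mono (Ideal.span_le.2 ?_)
    rintro _ ⟨i, rfl⟩
    exact hx i
  have hfg : ((Ideal.span (Set.range x)).map (algebraMap R A)).FG :=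
    Ideal.FG.map (Submodule.fg_span (Set.finite_range x)) _
  obtain ⟨k, hk⟩ := Ideal.exists_pow_le_of_le_radical_of_fg hle hfg
  refine ⟨f m, fun h => ?_, k, fun r hr => ?_⟩
  · obtain ⟨s, hs⟩ := (IsLocalizedModule.eq_zero_iff p.primeCompl f).1 h
    exact s.2 (hm.1.2 ((Ideal.mem_torsionOf_iff m (s : R)).2 hs))
  · rw [← Ideal.map_pow] at hk
    obtain ⟨s, hs, hsr⟩ := (IsLocalization.algebraMap_mem_map_algebraMap_iff p.primeCompl A _ r).1
      (hk (Ideal.mem_map_of_mem _ hr))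
    rw [← map_smul]
    refine (IsLocalizedModule.eq_zero_iff p.primeCompl f).2 ⟨⟨s, hs⟩, ?_⟩
    have := (Ideal.mem_torsionOf_iff m (s * r)).1 hsr
    rwa [mul_smul] at this
end

section
/- Let R be a commutative ring. An R-module M is nonzero if and only if there exists a prime ideal p of R such that for every finite sequence x₁,…,xₙ of elements of p, the (x₁,…,xₙ)-torsion submodule of the localization M_p of M at p is nonzero. -/
/-- If `p` is a minimal prime over `I`, then every `x ∈ p` has a power that lies in `I` up to a
multiplier outside `p`. -/
theorem Ideal.exists_mul_pow_mem_of_mem_minimalPrimes {R : Type*} [CommRing R] {I p : Ideal R}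
    (hp : p ∈ I.minimalPrimes) {x : R} (hx : x ∈ p) : ∃ s ∉ p, ∃ k : ℕ, s * x ^ k ∈ I := by
  have := hp.isPrime
  have h : algebraMap R (Localization.AtPrime p) x ∈
      (I.map (algebraMap R (Localization.AtPrime p))).radical := by
    rw [IsLocalization.AtPrime.radical_map_of_mem_minimalPrimes _ p I hp]
    exact Ideal.mem_map_of_mem _ hx
  obtain ⟨k, hk⟩ := h
  rw [← map_pow, IsLocalization.algebraMap_mem_map_algebraMap_iff p.primeCompl] at hk
  obtain ⟨s, hs, h⟩ := hk
  exact ⟨s, hs, k, h⟩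

theorem stmt_5 {R M : Type*} [CommRing R] [AddCommGroup M] [Module R M] :
    (∃ m : M, m ≠ 0) ↔
      ∃ p : PrimeSpectrum R,
        ∀ (n : ℕ) (x : Fin n → R), (∀ i, x i ∈ p.asIdeal) →
          ∃ m : LocalizedModule p.asIdeal.primeCompl M, m ≠ 0 ∧
            ∃ k : ℕ, ∀ r ∈ Ideal.span (Set.range x) ^ k, r • m = 0 := by
  constructor
  · rintro ⟨m, hm⟩
    have hI : Ideal.torsionOf R M m ≠ ⊤ := by
      rwa [Ne, Ideal.torsionOf_eq_top_iff]
    obtain ⟨p, hp⟩ := Ideal.nonempty_minimalPrimes hI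
    refine ⟨⟨p, hp.isPrime⟩, fun n x hx ↦ ?_⟩
    have := hp.isPrime
    refine ⟨LocalizedModule.mkLinearMap p.primeCompl M m, fun h ↦ ?_, ?_⟩
    · obtain ⟨s, hs, h⟩ := LocalizedModule.mem_ker_mkLinearMap_iff.mp (LinearMap.mem_ker.mpr h)
      exact hs (hp.le ((Ideal.mem_torsionOf_iff m s).mpr h))
    · refine Ideal.exists_pow_le_of_le_radical_of_fg
        (J := Ideal.torsionOf R _ (LocalizedModule.mkLinearMap p.primeCompl M m))
        (Ideal.span_le.mpr ?_) (Submodule.fg_span (Set.finite_range x))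
      rintro _ ⟨i, rfl⟩
      obtain ⟨s, hs, k, h⟩ := Ideal.exists_mul_pow_mem_of_mem_minimalPrimes hp (hx i)
      refine ⟨k, (Ideal.mem_torsionOf_iff _ _).mpr ?_⟩
      rw [← map_smul]
      refine LinearMap.mem_ker.mp (LocalizedModule.mem_ker_mkLinearMap_iff.mpr ⟨s, hs, ?_⟩)
      rwa [smul_smul]
  · rintro ⟨p, h⟩
    obtain ⟨m, hm, -⟩ := h 0 ![] (fun i ↦ i.elim0)
    induction m using LocalizedModule.induction_on with
    | h m s => exact ⟨m, fun h0 ↦ hm (h0 ▸ LocalizedModule.zero_mk s)⟩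
end

section
/- Let X be a topological space that is Noetherian and quasi-sober (every irreducible closed subset has a generic point). Then X is weakly scattered: every nonempty closed subset of X has a weakly isolated point. -/
/-- `p` is *weakly isolated* in `S` if there is an open `V` with
`p ∈ V ∩ S ⊆ closure {p}`. -/
def WeaklyIsolated {X : Type*} [TopologicalSpace X] (p : X) (S : Set X) : Prop :=
  ∃ V : Set X, IsOpen V ∧ p ∈ V ∩ S ∧ V ∩ S ⊆ closure {p}

theorem stmt_10 {X : Type*} [TopologicalSpace X]
    [TopologicalSpace.NoetherianSpace X] [QuasiSober X] :
    ∀ C : Set X, IsClosed C → C.Nonempty → ∃ p ∈ C, WeaklyIsolated p C := by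
  rintro C hC ⟨x, hx⟩
  have : TopologicalSpace.NoetherianSpace C :=
    Topology.IsInducing.subtypeVal.noetherianSpace
  have : QuasiSober C := hC.isClosedEmbedding_subtypeVal.quasiSober
  obtain ⟨U, hU, ⟨y, hy⟩, hUZ⟩ :=
    TopologicalSpace.NoetherianSpace.exists_isOpen_nonempty_subset_irreducibleComponent
      _ (irreducibleComponent_mem_irreducibleComponents (⟨x, hx⟩ : C))
  obtain ⟨p, hp⟩ := QuasiSober.sober (isIrreducible_irreducibleComponent (x := (⟨x, hx⟩ : C)))
    isClosed_irreducibleComponent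
  have hUp : U ⊆ closure {p} := hp.def.symm ▸ hUZ
  have hpU : p ∈ U := (specializes_iff_mem_closure.2 (hUp hy)).mem_open hU hy
  obtain ⟨V, hV, rfl⟩ := isOpen_induced_iff.1 hU
  refine ⟨p, p.2, V, hV, ⟨hpU, p.2⟩, fun q ⟨hqV, hqC⟩ => ?_⟩
  have hq : (⟨q, hqC⟩ : C) ∈ closure {p} := hUp hqV
  exact ((specializes_iff_mem_closure.2 hq).map continuous_subtype_val).mem_closure
end

section
/- For a topological space X, the following are equivalent: (i) every nonempty closed subset of X has a weakly isolated point; (ii) every closed subset of X equals the closure of its set of weakly isolated points. -/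
theorem stmt_12 {X : Type*} [TopologicalSpace X] :
    (∀ C : Set X, IsClosed C → C.Nonempty → ∃ p ∈ C, WeaklyIsolated p C) ↔
      (∀ C : Set X, IsClosed C → C = closure {p ∈ C | WeaklyIsolated p C}) := by
  constructor
  · intro h C hC
    refine Set.Subset.antisymm (fun x hx => ?_) (closure_minimal (fun p hp => hp.1) hC)
    rw [mem_closure_iff]
    intro U hU hxU
    obtain ⟨p, hpD, V, hV, hpV, hVD⟩ :=
      h (closure (C ∩ U)) isClosed_closure ⟨x, subset_closure ⟨hx, hxU⟩⟩
    obtain ⟨q, hqV, hqCU⟩ := mem_closure_iff.1 hpD V hV hpV.1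
    have hpU : p ∈ U := by
      obtain ⟨r, hrU, rfl⟩ :=
        mem_closure_iff.1 (hVD ⟨hqV, subset_closure hqCU⟩) U hU hqCU.2
      exact hrU
    have hpC : p ∈ C := closure_minimal Set.inter_subset_left hC hpD
    exact ⟨p, hpU, hpC, U ∩ V, hU.inter hV, ⟨⟨hpU, hpV.1⟩, hpC⟩,
      fun y hy => hVD ⟨hy.1.2, subset_closure ⟨hy.2, hy.1.1⟩⟩⟩
  · intro h C hC hne
    rw [h C hC, closure_nonempty_iff] at hne
    exact hne
end

section
/- Let X be a T₀ topological space. Then X is scattered if and only if X is weakly scattered and satisfies the separation axiom T_{1/2}, i.e. for every point p of X there exist an open set V and a closed set U with {p} = V ∩ U. -/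
theorem stmt_13 {X : Type*} [TopologicalSpace X] [T0Space X] :
    (∀ C : Set X, IsClosed C → C.Nonempty →
        ∃ p ∈ C, ∃ V : Set X, IsOpen V ∧ V ∩ C = {p}) ↔
      ((∀ C : Set X, IsClosed C → C.Nonempty → ∃ p ∈ C, WeaklyIsolated p C) ∧
        ∀ p : X, ∃ V U : Set X, IsOpen V ∧ IsClosed U ∧ ({p} : Set X) = V ∩ U) := by
  constructor
  · intro h
    refine ⟨fun C hC hne => ?_, fun p => ?_⟩
    · obtain ⟨p, hp, V, hV, hVC⟩ := h C hC hne
      exact ⟨p, hp, V, hV, hVC ▸ Set.mem_singleton p, hVC ▸ subset_closure⟩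
    · obtain ⟨q, hq, V, hV, hVC⟩ :=
        h (closure {p}) isClosed_closure ⟨p, subset_closure rfl⟩
      have hqV : q ∈ V := (hVC.symm.subset rfl).1
      have hpV : p ∈ V := by
        obtain ⟨x, hxV, rfl⟩ := mem_closure_iff.1 hq V hV hqV
        exact hxV
      have hpq : p = q := hVC.subset ⟨hpV, subset_closure rfl⟩
      subst hpq
      exact ⟨V, closure {p}, hV, isClosed_closure, hVC.symm⟩
  · rintro ⟨hweak, hsep⟩ C hC hne
    obtain ⟨p, hp, V, hV, hpV, hVC⟩ := hweak C hC hne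
    obtain ⟨W, U, hW, hU, hWU⟩ := hsep p
    have hpWU : p ∈ W ∩ U := hWU.subset rfl
    refine ⟨p, hp, V ∩ W, hV.inter hW, Set.Subset.antisymm ?_ ?_⟩
    · rintro x ⟨⟨hxV, hxW⟩, hxC⟩
      have hxU : x ∈ U :=
        closure_minimal (Set.singleton_subset_iff.2 hpWU.2) hU (hVC ⟨hxV, hxC⟩)
      exact hWU.symm.subset ⟨hxW, hxU⟩
    · exact Set.singleton_subset_iff.2 ⟨⟨hpV.1, hpWU.1⟩, hp⟩
end

section
/- Let R be a commutative ring and equip the set Spec R with the Hochster dual topology, whose open sets are exactly the Thomason subsets of Spec R. If Spec R with the Hochster dual topology is scattered (every nonempty dual-closed subset has a point isolated in the dual subspace topology), then every point of Spec R is visible. -/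
theorem stmt_15 {R : Type*} [CommRing R]
    (τ : TopologicalSpace (PrimeSpectrum R))
    (hτ : ∀ V : Set (PrimeSpectrum R), τ.IsOpen V ↔ IsThomason V)
    (hscat : ∀ C : Set (PrimeSpectrum R), @IsClosed _ τ C → C.Nonempty →
      ∃ p ∈ C, ∃ V : Set (PrimeSpectrum R), τ.IsOpen V ∧ V ∩ C = {p}) :
    ∀ p : PrimeSpectrum R, VisiblePoint p := by
  intro p
  have hC : @IsClosed _ τ (@closure _ τ {p}) := @isClosed_closure _ τ {p}
  have hp : p ∈ @closure _ τ {p} := @subset_closure _ τ {p} p rfl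
  obtain ⟨q, hq, V, hV, hVC⟩ := hscat _ hC ⟨p, hp⟩
  have hqV : q ∈ V := (hVC.symm.subset rfl).1
  obtain ⟨r, hrV, rfl⟩ := (@mem_closure_iff _ τ q {p}).1 hq V hV hqV
  obtain rfl : r = q := hVC.subset ⟨hrV, hp⟩
  exact ⟨V, (@closure _ τ {r})ᶜ, (hτ V).1 hV, (hτ _).1 (@IsClosed.isOpen_compl _ τ _ hC),
    by rw [compl_compl, hVC]⟩
end

section
/- Let k be an algebraically closed field and R = k[x₁, x₂, x₃, …] the polynomial ring over k in countably many variables. Then for every prime ideal p of R and every finite family f₁, …, f_s of elements of p, there exists a prime ideal q of R with f_i ∈ q for all i and q ⊄ p. -/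
/-- Substituting for a variable that does not occur in a polynomial leaves it unchanged. -/
theorem MvPolynomial.aeval_update_X_of_notMem_vars {σ R : Type*} [CommSemiring R] [DecidableEq σ]
    {g : MvPolynomial σ R} {n : σ} (hn : n ∉ g.vars) (c : MvPolynomial σ R) :
    MvPolynomial.aeval (Function.update MvPolynomial.X n c) g = g := by
  refine (MvPolynomial.hom_congr_vars
    (f₁ := (MvPolynomial.aeval (Function.update MvPolynomial.X n c)).toRingHom)
    (f₂ := RingHom.id _) ?_ ?_ rfl)
  · ext; simp
  · intro i hi _
    have hin : i ≠ n := fun h => hn (h ▸ hi)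
    simp [hin]

theorem stmt_16 {k : Type*} [Field k] [IsAlgClosed k]
    (p : Ideal (MvPolynomial ℕ k)) (hp : p.IsPrime)
    (s : ℕ) (f : Fin s → MvPolynomial ℕ k) (hf : ∀ i, f i ∈ p) :
    ∃ q : Ideal (MvPolynomial ℕ k), q.IsPrime ∧ (∀ i, f i ∈ q) ∧ ¬ q ≤ p := by
  obtain ⟨n, hn⟩ := Infinite.exists_notMem_finset (Finset.univ.biUnion fun i => (f i).vars)
  have hn' : ∀ i, n ∉ (f i).vars := by simpa using hn
  -- The preimage of `p` under the substitution `X n ↦ c` contains every `f i` and `X n - c`.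
  let φ (c : k) := MvPolynomial.aeval (R := k)
    (Function.update MvPolynomial.X n (MvPolynomial.C (σ := ℕ) c))
  have hprime (c : k) : (p.comap (φ c)).IsPrime := Ideal.comap_isPrime (φ c) p
  have hmem (c : k) (i : Fin s) : f i ∈ p.comap (φ c) := by
    rw [Ideal.mem_comap, MvPolynomial.aeval_update_X_of_notMem_vars (hn' i)]
    exact hf i
  have hsub (c : k) : MvPolynomial.X n - MvPolynomial.C c ∈ p.comap (φ c) := by
    simp [φ, Ideal.mem_comap, MvPolynomial.algebraMap_eq]
  by_contra! h
  have h0 := h _ (hprime 0) (hmem 0) (hsub 0)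
  have h1 := h _ (hprime 1) (hmem 1) (hsub 1)
  refine hp.ne_top ((Ideal.eq_top_iff_one p).2 ?_)
  simpa using p.sub_mem h0 h1
end
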